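/- For every n ≥ 1 and any points λ_1, …, λ_n ∈ ℂ, letting μ = (1/n) Σ_{j=1}^n δ_{λ_j}, there exists a ball of radius r = 1/(10√n) contained in the closed unit disk B_1(0) that contains none of the points λ_1, …, λ_n; consequently D(μ, μ_∞) ≥ 1/(100 n). -/

import Mathlib

open MeasureTheory Metric Filter
open scoped ENNReal NNReal Topology

/-- The spherical Kolmogorov distance. -/
noncomputable def sphKol (μ ν : Measure ℂ) : ℝ :=
  ⨆ q : ℂ × {r : ℝ // 0 < r},
    |(μ (closedBall q.1 q.2.1)).toReal - (ν (closedBall q.1 q.2.1)).toReal|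

/-- The circular law: uniform distribution on the closed unit disk. -/
noncomputable def circularLaw : Measure ℂ :=
  (ENNReal.ofReal Real.pi)⁻¹ • volume.restrict (closedBall (0 : ℂ) 1)

/-- The values of two finite measures on a ball differ by at most their spherical
Kolmogorov distance. -/
theorem abs_sub_closedBall_le_sphKol (μ ν : Measure ℂ) [IsFiniteMeasure μ] [IsFiniteMeasure ν]
    (z : ℂ) {r : ℝ} (hr : 0 < r) :
    |μ.real (closedBall z r) - ν.real (closedBall z r)| ≤ sphKol μ ν := by
  refine le_ciSup (f := fun q : ℂ × {r : ℝ // 0 < r} =>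
    |(μ (closedBall q.1 q.2.1)).toReal - (ν (closedBall q.1 q.2.1)).toReal|)
    ⟨μ.real Set.univ + ν.real Set.univ, ?_⟩ (z, ⟨r, hr⟩)
  rintro _ ⟨q, rfl⟩
  have hμ := measureReal_mono (μ := μ) (Set.subset_univ (closedBall q.1 q.2.1))
  have hν := measureReal_mono (μ := ν) (Set.subset_univ (closedBall q.1 q.2.1))
  have hμ0 := measureReal_nonneg (μ := μ) (s := closedBall q.1 q.2.1)
  have hν0 := measureReal_nonneg (μ := ν) (s := closedBall q.1 q.2.1)
  simp only [measureReal_def] at *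
  exact abs_le.2 ⟨by linarith, by linarith⟩

instance isFiniteMeasure_circularLaw : IsFiniteMeasure circularLaw :=
  have : IsFiniteMeasure (volume.restrict (closedBall (0 : ℂ) 1)) :=
    isFiniteMeasure_restrict.2 measure_closedBall_lt_top.ne
  Measure.smul_finite _ (by simp [Real.pi_pos])

theorem volumeReal_closedBall (z : ℂ) {r : ℝ} (hr : 0 ≤ r) :
    (volume (closedBall z r)).toReal = r ^ 2 * Real.pi := by
  simp [Complex.volume_closedBall, hr]

theorem circularLaw_closedBall_toReal {z : ℂ} {r : ℝ} (hr : 0 ≤ r)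
    (h : closedBall z r ⊆ closedBall 0 1) :
    (circularLaw (closedBall z r)).toReal = r ^ 2 := by
  rw [circularLaw, Measure.smul_apply, Measure.restrict_eq_self _ h, smul_eq_mul,
    ENNReal.toReal_mul, volumeReal_closedBall z hr, ENNReal.toReal_inv,
    ENNReal.toReal_ofReal Real.pi_pos.le]
  field_simp

/-- If `n` disks of radius `r` have total area less than that of a disk of radius `s`,
then the disk of radius `s` around `0` has a point at distance more than `r` from
all of `n` given points. -/
theorem exists_mem_closedBall_forall_notMem_closedBall {n : ℕ} (Λ : Fin n → ℂ) {r s : ℝ}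
    (hr : 0 ≤ r) (hs : 0 ≤ s) (h : n * r ^ 2 < s ^ 2) :
    ∃ z ∈ closedBall (0 : ℂ) s, ∀ j, Λ j ∉ closedBall z r := by
  by_contra! hcover
  have hsub : closedBall (0 : ℂ) s ⊆ ⋃ j, closedBall (Λ j) r := fun z hz => by
    obtain ⟨j, hj⟩ := hcover z hz
    exact Set.mem_iUnion.2 ⟨j, mem_closedBall_comm.1 hj⟩
  have hle : volume.real (closedBall (0 : ℂ) s) ≤ ∑ j, volume.real (closedBall (Λ j) r) :=
    (measureReal_mono hsub ((measure_iUnion_le _).trans_lt (by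
      rw [tsum_fintype]
      exact ENNReal.sum_lt_top.2 fun j _ => measure_closedBall_lt_top)).ne).trans
      (measureReal_iUnion_fintype_le _)
  simp only [measureReal_def, volumeReal_closedBall _ hr, volumeReal_closedBall _ hs,
    Finset.sum_const, Finset.card_univ, Fintype.card_fin, nsmul_eq_mul, ← mul_assoc] at hle
  exact h.not_ge (le_of_mul_le_mul_right hle Real.pi_pos)

/-- **A lower bound for the Kolmogorov distance of atomic measures** (remark in Section 1):
for any `n` points there is a ball of radius `1/(10√n)` inside the closed unit disk
containing none of them, whence `D(μ, μ_∞) ≥ 1/(100 n)` for the empirical measure `μ`. -/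
theorem empirical_measure_lower_bound (n : ℕ) (hn : 1 ≤ n) (Λ : Fin n → ℂ) :
    (∃ z₀ : ℂ, closedBall z₀ (1 / (10 * Real.sqrt n)) ⊆ closedBall (0 : ℂ) 1 ∧
        ∀ j, Λ j ∉ closedBall z₀ (1 / (10 * Real.sqrt n))) ∧
      1 / (100 * (n : ℝ)) ≤
        sphKol ((n : ℝ≥0∞)⁻¹ • ∑ j : Fin n, Measure.dirac (Λ j)) circularLaw := by
  have hn' : (1 : ℝ) ≤ n := by exact_mod_cast hn
  have hsqrt : 1 ≤ Real.sqrt n := Real.one_le_sqrt.2 hn'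
  set r : ℝ := 1 / (10 * Real.sqrt n) with hr
  have hr0 : 0 < r := by positivity
  have hr10 : r ≤ 1 / 10 := by
    rw [hr]
    gcongr
    linarith
  have hr2 : r ^ 2 = 1 / (100 * n) := by
    rw [hr, div_pow, mul_pow, Real.sq_sqrt (by positivity)]
    norm_num
  have hnr2 : n * r ^ 2 = 1 / 100 := by
    rw [hr2]
    field_simp
  obtain ⟨z₀, hz₀, hfree⟩ := exists_mem_closedBall_forall_notMem_closedBall Λ
    (s := 1 - r) hr0.le (by linarith) (by rw [hnr2]; nlinarith)
  have hsub : closedBall z₀ r ⊆ closedBall (0 : ℂ) 1 :=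
    closedBall_subset_closedBall' (by rw [mem_closedBall] at hz₀; linarith)
  refine ⟨⟨z₀, hsub, hfree⟩, ?_⟩
  have hμ : ((n : ℝ≥0∞)⁻¹ • ∑ j : Fin n, Measure.dirac (Λ j)) (closedBall z₀ r) = 0 := by
    simp [Measure.dirac_apply' _ isClosed_closedBall.measurableSet, hfree]
  have : IsFiniteMeasure ((n : ℝ≥0∞)⁻¹ • ∑ j : Fin n, Measure.dirac (Λ j)) :=
    Measure.smul_finite _ (by simp; lia)
  have h := abs_sub_closedBall_le_sphKol
    ((n : ℝ≥0∞)⁻¹ • ∑ j : Fin n, Measure.dirac (Λ j)) circularLaw z₀ hr0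
  rwa [measureReal_def, measureReal_def, hμ, circularLaw_closedBall_toReal hr0.le hsub,
    ENNReal.toReal_zero, zero_sub, abs_neg, abs_of_nonneg (sq_nonneg r), hr2] at h
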